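/- Expected norm of a linear image of a standard Gaussian: if u ~ N(0, σ² I_n) and Z ∈ ℝ^{r×n} with ‖Z‖_F = 1, then E[‖Z u‖₂] ≥ σ √(2/π), with equality when Z has rank 1. -/

import Mathlib

open MeasureTheory ProbabilityTheory

/-- Euclidean norm of a finite-dimensional real vector. -/
noncomputable def eNorm {ι : Type*} [Fintype ι] (v : ι → ℝ) : ℝ :=
  Real.sqrt (∑ i, v i ^ 2)

/-- Frobenius norm of a real matrix. -/
noncomputable def frobNorm {ι κ : Type*} [Fintype ι] [Fintype κ] (Z : Matrix ι κ ℝ) : ℝ :=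
  Real.sqrt (∑ i, ∑ j, Z i j ^ 2)

lemma eNorm_nonneg {ι : Type*} [Fintype ι] (v : ι → ℝ) : 0 ≤ eNorm v := Real.sqrt_nonneg _

lemma eNorm_sq {ι : Type*} [Fintype ι] (v : ι → ℝ) : eNorm v ^ 2 = ∑ i, v i ^ 2 :=
  Real.sq_sqrt (Finset.sum_nonneg fun _ _ ↦ sq_nonneg _)

lemma eNorm_smul {ι : Type*} [Fintype ι] (c : ℝ) (v : ι → ℝ) : eNorm (c • v) = |c| * eNorm v := by
  simp_rw [eNorm, Pi.smul_apply, smul_eq_mul, mul_pow, ← Finset.mul_sum]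
  rw [Real.sqrt_mul (sq_nonneg c), Real.sqrt_sq_eq_abs]

lemma eNorm_le_sum_abs {ι : Type*} [Fintype ι] (v : ι → ℝ) : eNorm v ≤ ∑ i, |v i| := by
  refine Real.sqrt_le_iff.2 ⟨Finset.sum_nonneg fun _ _ ↦ abs_nonneg _, ?_⟩
  simpa only [sq_abs] using
    Finset.sum_sq_le_sq_sum_of_nonneg (s := Finset.univ) (f := fun i ↦ |v i|)
      (fun _ _ ↦ abs_nonneg _)

lemma measurable_eNorm {ι : Type*} [Fintype ι] : Measurable (eNorm : (ι → ℝ) → ℝ) := by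
  unfold eNorm
  fun_prop

lemma frobNorm_eq_eNorm_rows {ι κ : Type*} [Fintype ι] [Fintype κ] (Z : Matrix ι κ ℝ) :
    frobNorm Z = eNorm fun i ↦ eNorm (Z i) := by
  simp_rw [frobNorm, eNorm.eq_1 (fun i ↦ eNorm (Z i)), eNorm_sq]

lemma frobNorm_vecMulVec {ι κ : Type*} [Fintype ι] [Fintype κ] (v : ι → ℝ) (b : κ → ℝ) :
    frobNorm (Matrix.vecMulVec v b) = eNorm v * eNorm b := by
  simp_rw [frobNorm, eNorm, Matrix.vecMulVec_apply, mul_pow, ← Finset.mul_sum, ← Finset.sum_mul]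
  rw [Real.sqrt_mul (Finset.sum_nonneg fun _ _ ↦ sq_nonneg _)]

/-- Cauchy–Schwarz, with the rows of `Z` weighted by their norms. -/
lemma sum_eNorm_row_mul_abs_le {ι κ : Type*} [Fintype ι] [Fintype κ] (Z : Matrix ι κ ℝ)
    (u : κ → ℝ) : ∑ i, eNorm (Z i) * |Z i ⬝ᵥ u| ≤ frobNorm Z * eNorm (Z.mulVec u) := by
  rw [frobNorm_eq_eNorm_rows]
  simpa only [sq_abs, eNorm.eq_1 (Z.mulVec u), eNorm.eq_1 (fun i ↦ eNorm (Z i)), Matrix.mulVec]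
    using Real.sum_mul_le_sqrt_mul_sqrt Finset.univ
    (fun i ↦ eNorm (Z i)) (fun i ↦ |Z i ⬝ᵥ u|)

lemma Matrix.exists_eq_vecMulVec_of_rank_eq_one {ι κ : Type*} [Fintype κ]
    [DecidableEq κ] {Z : Matrix ι κ ℝ} (h : Z.rank = 1) :
    ∃ v b, Z = Matrix.vecMulVec v b := by
  obtain ⟨v, -, hv⟩ := finrank_eq_one_iff'.1 h
  choose c hc using hv
  refine ⟨v, fun j ↦ c ⟨Z.mulVecLin (Pi.single j 1), LinearMap.mem_range_self _ _⟩, ?_⟩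
  ext i j
  have := congrFun (congrArg Subtype.val
    (hc ⟨Z.mulVecLin (Pi.single j 1), LinearMap.mem_range_self _ _⟩)) i
  simp only [Submodule.coe_smul, Pi.smul_apply, smul_eq_mul, Matrix.mulVecLin_apply,
    Matrix.mulVec_single_one, Matrix.col_apply] at this
  rw [Matrix.vecMulVec_apply, mul_comm]
  simpa using this.symm

lemma integral_abs_gaussianReal (v : NNReal) :
    ∫ x, |x| ∂(gaussianReal 0 v) = Real.sqrt v * Real.sqrt (2 / Real.pi) := by
  rcases eq_or_ne v 0 with rfl | hv
  · simp
  have hv' : (0 : ℝ) < v := by positivity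
  have hint : ∫ x in Set.Ioi (0 : ℝ), x * Real.exp (-(2 * (v : ℝ))⁻¹ * x ^ 2) = v := by
    have := integral_rpow_mul_exp_neg_mul_rpow (p := 2) (q := 1) (b := (2 * (v : ℝ))⁻¹)
      (by norm_num) (by norm_num) (by positivity)
    norm_num only [Real.rpow_one, Real.rpow_two, Real.rpow_neg_one, Real.Gamma_one, inv_inv]
      at this
    rw [this]
    ring
  have hfun : ∀ x : ℝ, gaussianPDFReal 0 v x • |x| =
      (Real.sqrt (2 * Real.pi * v))⁻¹ * (|x| * Real.exp (-(2 * (v : ℝ))⁻¹ * |x| ^ 2)) := by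
    intro x
    rw [gaussianPDFReal, sq_abs, smul_eq_mul, sub_zero]
    ring_nf
  rw [integral_gaussianReal_eq_integral_smul hv]
  simp_rw [hfun]
  rw [integral_const_mul,
    integral_comp_abs (f := fun x ↦ x * Real.exp (-(2 * (v : ℝ))⁻¹ * x ^ 2)), hint]
  rw [← Real.sqrt_mul hv'.le, inv_mul_eq_div, div_eq_iff (by positivity),
    ← Real.sqrt_mul (by positivity)]
  symm
  rw [Real.sqrt_eq_iff_mul_self_eq (by positivity) (by positivity)]
  field_simp

section LinearForm

variable {κ : Type*} [Fintype κ]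

lemma map_dotProduct_pi_gaussianReal (b : κ → ℝ) (v : NNReal) :
    (Measure.pi fun _ : κ ↦ gaussianReal 0 v).map (fun u ↦ b ⬝ᵥ u) =
      gaussianReal 0 ((∑ i, b i ^ 2).toNNReal * v) := by
  have hmeas : Measurable fun u : κ → ℝ ↦ b ⬝ᵥ u := by unfold dotProduct; fun_prop
  have := Measure.isProbabilityMeasure_map (μ := Measure.pi fun _ : κ ↦ gaussianReal 0 v)
    hmeas.aemeasurable
  apply Measure.ext_of_charFun
  ext t
  rw [charFun_gaussianReal, charFun_apply_real, integral_map hmeas.aemeasurable (by fun_prop)]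
  have hprod : ∀ u : κ → ℝ, Complex.exp (t * (b ⬝ᵥ u : ℝ) * Complex.I) =
      ∏ i, Complex.exp ((t * b i : ℝ) * u i * Complex.I) := by
    intro u
    rw [← Complex.exp_sum, dotProduct]
    push_cast
    rw [Finset.mul_sum, Finset.sum_mul]
    simp_rw [mul_assoc]
  simp_rw [hprod]
  rw [integral_fintype_prod_eq_prod
    (f := fun i x ↦ Complex.exp ((t * b i : ℝ) * (x : ℝ) * Complex.I))]
  simp_rw [← charFun_apply_real, charFun_gaussianReal, ← Complex.exp_sum]
  have hs : ((∑ i, b i ^ 2).toNNReal : ℝ) = ∑ i, b i ^ 2 :=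
    Real.coe_toNNReal _ (Finset.sum_nonneg fun _ _ ↦ sq_nonneg _)
  rw [NNReal.coe_mul, hs]
  push_cast
  congr 1
  simp only [mul_zero, zero_mul, zero_sub, Finset.sum_neg_distrib, Finset.sum_mul, Finset.sum_div]
  congr 1
  refine Finset.sum_congr rfl fun i _ ↦ ?_
  ring

lemma integrable_dotProduct_pi_gaussianReal (b : κ → ℝ) (v : NNReal) :
    Integrable (fun u ↦ b ⬝ᵥ u) (Measure.pi fun _ : κ ↦ gaussianReal 0 v) :=
  integrable_finsetSum _ fun _ _ ↦ (integrable_eval IsGaussian.integrable_id).const_mul _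

lemma integral_abs_dotProduct_pi_gaussianReal (b : κ → ℝ) (σ : NNReal) :
    ∫ u, |b ⬝ᵥ u| ∂(Measure.pi fun _ : κ ↦ gaussianReal 0 (σ ^ 2)) =
      eNorm b * (σ * Real.sqrt (2 / Real.pi)) := by
  have hmeas : Measurable fun u : κ → ℝ ↦ b ⬝ᵥ u := by unfold dotProduct; fun_prop
  have hs : (0 : ℝ) ≤ ∑ i, b i ^ 2 := Finset.sum_nonneg fun _ _ ↦ sq_nonneg _
  rw [← integral_map (f := fun x : ℝ ↦ |x|) hmeas.aemeasurable (by fun_prop),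
    map_dotProduct_pi_gaussianReal, integral_abs_gaussianReal, NNReal.coe_mul,
    Real.coe_toNNReal _ hs, Real.sqrt_mul hs, NNReal.coe_pow, Real.sqrt_sq σ.coe_nonneg,
    ← eNorm, mul_assoc]

lemma integrable_eNorm_mulVec_pi_gaussianReal {ι : Type*} [Fintype ι] (Z : Matrix ι κ ℝ)
    (v : NNReal) :
    Integrable (fun u ↦ eNorm (Z.mulVec u)) (Measure.pi fun _ : κ ↦ gaussianReal 0 v) := by
  refine (integrable_finsetSum Finset.univ fun i _ ↦
    (integrable_dotProduct_pi_gaussianReal (Z i) v).abs).mono' ?_ (.of_forall fun u ↦ ?_)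
  · refine (measurable_eNorm.comp ?_).aestronglyMeasurable
    unfold Matrix.mulVec dotProduct
    fun_prop
  · rw [Real.norm_of_nonneg (eNorm_nonneg _)]
    exact eNorm_le_sum_abs _

end LinearForm

theorem stmt8 {r n : ℕ} (σ : NNReal) (hσ : 0 < σ)
    (Z : Matrix (Fin r) (Fin n) ℝ) (hZ : frobNorm Z = 1) :
    ((σ : ℝ) * Real.sqrt (2 / Real.pi) ≤
        ∫ u, eNorm (Z.mulVec u) ∂(Measure.pi fun _ : Fin n => gaussianReal 0 (σ ^ 2))) ∧
      (Z.rank = 1 →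
        (∫ u, eNorm (Z.mulVec u) ∂(Measure.pi fun _ : Fin n => gaussianReal 0 (σ ^ 2))) =
          (σ : ℝ) * Real.sqrt (2 / Real.pi)) := by
  constructor
  · have hint : ∀ i, Integrable (fun u ↦ eNorm (Z i) * |Z i ⬝ᵥ u|)
        (Measure.pi fun _ : Fin n ↦ gaussianReal 0 (σ ^ 2)) := fun i ↦
      (integrable_dotProduct_pi_gaussianReal (Z i) _).abs.const_mul _
    calc (σ : ℝ) * Real.sqrt (2 / Real.pi)
        = ∑ i, eNorm (Z i) * (eNorm (Z i) * (σ * Real.sqrt (2 / Real.pi))) := by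
          simp_rw [← mul_assoc (eNorm _) (eNorm _), ← sq, ← Finset.sum_mul]
          rw [← eNorm_sq, ← frobNorm_eq_eNorm_rows, hZ, one_pow, one_mul]
      _ = ∫ u, ∑ i, eNorm (Z i) * |Z i ⬝ᵥ u|
            ∂(Measure.pi fun _ : Fin n ↦ gaussianReal 0 (σ ^ 2)) := by
          rw [integral_finsetSum _ fun i _ ↦ hint i]
          simp_rw [integral_const_mul, integral_abs_dotProduct_pi_gaussianReal]
      _ ≤ _ := by
          refine integral_mono (integrable_finsetSum _ fun i _ ↦ hint i)
            (integrable_eNorm_mulVec_pi_gaussianReal Z _) fun u ↦ ?_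
          simpa only [hZ, one_mul] using sum_eNorm_row_mul_abs_le Z u
  · intro hrank
    obtain ⟨v, b, rfl⟩ := Matrix.exists_eq_vecMulVec_of_rank_eq_one hrank
    have hnorm : ∀ u, eNorm ((Matrix.vecMulVec v b).mulVec u) = eNorm v * |b ⬝ᵥ u| := by
      intro u
      rw [Matrix.vecMulVec_mulVec, op_smul_eq_smul, eNorm_smul, mul_comm]
    simp_rw [hnorm]
    rw [integral_const_mul, integral_abs_dotProduct_pi_gaussianReal, ← mul_assoc,
      ← frobNorm_vecMulVec, hZ, one_mul]
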